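/- Let p be a prime with p ≡ 1 (mod 6). Then Σ_{k=0}^{p−1} ( C(3k,k)·C(6k,3k)/432^k ) · p/(6k + 1) ≡ ((5 − 2^p)/3) · (−1)^{(p−1)/6} · C((p−1)/3, (p−1)/6) (mod p²). -/

import Mathlib

/-- A rational number is a `p`-integer if its denominator (in lowest terms)
is not divisible by `p`. -/
def isPInt (p : ℕ) (x : ℚ) : Prop := ¬ p ∣ x.den

/-- For `p`-integers `u, v`, `u ≡ v (mod p^k)` means `(u - v)/p^k` is a `p`-integer. -/
def pCong (p k : ℕ) (u v : ℚ) : Prop := isPInt p ((u - v) / (p : ℚ) ^ k)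

open Finset

/-- The subring of `ℚ` formed by the `p`-integers. -/
def pIntegers (p : ℕ) [hp : Fact p.Prime] : Subring ℚ where
  carrier := {x | isPInt p x}
  mul_mem' {a b} ha hb h :=
    ((Nat.Prime.dvd_mul hp.out).1 (h.trans (Rat.mul_den_dvd a b))).elim ha hb
  one_mem' := by simpa [isPInt] using hp.out.one_lt.ne'
  add_mem' {a b} ha hb h :=
    ((Nat.Prime.dvd_mul hp.out).1 (h.trans (Rat.add_den_dvd a b))).elim ha hb
  zero_mem' := by simpa [isPInt] using hp.out.one_lt.ne'
  neg_mem' {a} ha := by simpa [isPInt] using ha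

section Congruence

variable {p : ℕ} [hp : Fact p.Prime]

lemma inv_intCast_mem_pIntegers {d : ℤ} (hd : ¬ (p : ℤ) ∣ d) : (d : ℚ)⁻¹ ∈ pIntegers p := by
  intro h
  apply hd
  have h1 : ((Rat.divInt 1 d).den : ℤ) ∣ d := Rat.den_dvd 1 d
  have h2 : Rat.divInt 1 d = (d : ℚ)⁻¹ := by simp [Rat.divInt_eq_div]
  rw [h2] at h1
  exact (Int.natCast_dvd_natCast.2 h).trans h1

lemma inv_natCast_mem_pIntegers {d : ℕ} (hd : ¬ p ∣ d) : (d : ℚ)⁻¹ ∈ pIntegers p := by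
  simpa using inv_intCast_mem_pIntegers (p := p) (d := d) (by exact_mod_cast hd)

lemma inv_succ_mem_pIntegers {j : ℕ} (hj : j + 1 < p) : ((j : ℚ) + 1)⁻¹ ∈ pIntegers p := by
  have := inv_natCast_mem_pIntegers (p := p) (Nat.not_dvd_of_pos_of_lt j.succ_pos hj)
  simpa using this

lemma pCong_iff {k : ℕ} {u v : ℚ} :
    pCong p k u v ↔ ∃ r ∈ pIntegers p, u = v + (p : ℚ) ^ k * r := by
  have h0 : (p : ℚ) ^ k ≠ 0 := pow_ne_zero _ (Nat.cast_ne_zero.2 hp.out.ne_zero)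
  constructor
  · intro h
    exact ⟨_, h, by field_simp; ring⟩
  · rintro ⟨r, hr, rfl⟩
    have : (v + (p : ℚ) ^ k * r - v) / (p : ℚ) ^ k = r := by field_simp; ring
    rw [pCong, this]
    exact hr

lemma pCong_of_eq_add {k : ℕ} {u v r : ℚ} (hr : r ∈ pIntegers p)
    (h : u = v + (p : ℚ) ^ k * r) : pCong p k u v :=
  pCong_iff.2 ⟨r, hr, h⟩

lemma pCong_refl (k : ℕ) (u : ℚ) : pCong p k u u :=
  pCong_of_eq_add (zero_mem _) (by ring)

lemma pCong.symm {k : ℕ} {u v : ℚ} (h : pCong p k u v) : pCong p k v u := by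
  obtain ⟨r, hr, rfl⟩ := pCong_iff.1 h
  exact pCong_of_eq_add (neg_mem hr) (by ring)

lemma pCong.trans {k : ℕ} {u v w : ℚ} (h : pCong p k u v) (h' : pCong p k v w) :
    pCong p k u w := by
  obtain ⟨r, hr, rfl⟩ := pCong_iff.1 h
  obtain ⟨s, hs, rfl⟩ := pCong_iff.1 h'
  exact pCong_of_eq_add (add_mem hs hr) (by ring)

lemma pCong.add {k : ℕ} {u v u' v' : ℚ} (h : pCong p k u v) (h' : pCong p k u' v') :
    pCong p k (u + u') (v + v') := by
  obtain ⟨r, hr, rfl⟩ := pCong_iff.1 h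
  obtain ⟨s, hs, rfl⟩ := pCong_iff.1 h'
  exact pCong_of_eq_add (add_mem hr hs) (by ring)

lemma pCong.mul_left {k : ℕ} {u v c : ℚ} (hc : c ∈ pIntegers p) (h : pCong p k u v) :
    pCong p k (c * u) (c * v) := by
  obtain ⟨r, hr, rfl⟩ := pCong_iff.1 h
  exact pCong_of_eq_add (mul_mem hc hr) (by ring)

lemma pCong.sub {k : ℕ} {u v u' v' : ℚ} (h : pCong p k u v) (h' : pCong p k u' v') :
    pCong p k (u - u') (v - v') := by
  have := h.add (h'.mul_left (c := -1) (neg_mem (one_mem _)))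
  simpa [sub_eq_add_neg] using this

lemma pCong.prime_mul {k : ℕ} {u v : ℚ} (h : pCong p k u v) :
    pCong p (k + 1) (p * u) (p * v) := by
  obtain ⟨r, hr, rfl⟩ := pCong_iff.1 h
  exact pCong_of_eq_add hr (by ring)

lemma pCong.mem {k : ℕ} {u v : ℚ} (h : pCong p k u v) (hv : v ∈ pIntegers p) :
    u ∈ pIntegers p := by
  obtain ⟨r, hr, rfl⟩ := pCong_iff.1 h
  exact add_mem hv (mul_mem (pow_mem (natCast_mem _ _) _) hr)

lemma pCong.mul {k : ℕ} {u v u' v' : ℚ} (h : pCong p k u v) (h' : pCong p k u' v')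
    (hv : v ∈ pIntegers p) (hv' : v' ∈ pIntegers p) : pCong p k (u * u') (v * v') := by
  have h1 := h.mul_left (h'.mem hv')
  have h2 := h'.mul_left hv
  rw [mul_comm, mul_comm u'] at h1
  exact h1.trans h2

lemma pCong_sum {ι : Type*} {k : ℕ} {s : Finset ι} {f g : ι → ℚ}
    (h : ∀ i ∈ s, pCong p k (f i) (g i)) : pCong p k (∑ i ∈ s, f i) (∑ i ∈ s, g i) := by
  classical
  induction s using Finset.induction_on with
  | empty => simpa using pCong_refl (p := p) k 0
  | insert a s ha ih =>
    rw [sum_insert ha, sum_insert ha]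
    exact (h a (mem_insert_self a s)).add (ih fun i hi => h i (mem_insert_of_mem hi))

lemma pCong_prod {ι : Type*} {k : ℕ} {s : Finset ι} {f g : ι → ℚ}
    (h : ∀ i ∈ s, pCong p k (f i) (g i)) (hg : ∀ i ∈ s, g i ∈ pIntegers p) :
    pCong p k (∏ i ∈ s, f i) (∏ i ∈ s, g i) := by
  classical
  induction s using Finset.induction_on with
  | empty => simpa using pCong_refl (p := p) k 1
  | insert a s ha ih =>
    rw [prod_insert ha, prod_insert ha]
    exact (h a (mem_insert_self a s)).mul
      (ih (fun i hi => h i (mem_insert_of_mem hi)) fun i hi => hg i (mem_insert_of_mem hi))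
      (hg a (mem_insert_self a s)) (prod_mem fun i hi => hg i (mem_insert_of_mem hi))

lemma pCong_prod_one_add {ι : Type*} {s : Finset ι} {c : ι → ℚ}
    (hc : ∀ i ∈ s, c i ∈ pIntegers p) :
    pCong p 2 (∏ i ∈ s, (1 + p * c i)) (1 + p * ∑ i ∈ s, c i) := by
  classical
  induction s using Finset.induction_on with
  | empty => simpa using pCong_refl (p := p) 2 1
  | insert a s ha ih =>
    have hs : ∀ i ∈ s, c i ∈ pIntegers p := fun i hi => hc i (mem_insert_of_mem hi)
    have ha' := hc a (mem_insert_self a s)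
    rw [prod_insert ha, sum_insert ha]
    refine ((ih hs).mul_left (add_mem (one_mem _) (mul_mem (natCast_mem _ _) ha'))).trans ?_
    exact pCong_of_eq_add (mul_mem ha' (sum_mem hs)) (by ring)

end Congruence

section HypergeometricTerm

lemma choose_mul_choose_div_eq_prod (k : ℕ) :
    ((3 * k).choose k : ℚ) * ((6 * k).choose (3 * k) : ℚ) / 432 ^ k =
      ∏ j ∈ range k, (6 * (j : ℚ) + 1) * (6 * j + 5) / (36 * ((j : ℚ) + 1) ^ 2) := by
  have hf : ∀ k : ℕ, ((3 * k).choose k : ℚ) * ((6 * k).choose (3 * k) : ℚ) =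
      (6 * k).factorial / (k.factorial * (2 * k).factorial * (3 * k).factorial) := by
    intro k
    rw [Nat.cast_choose ℚ (by omega : k ≤ 3 * k), Nat.cast_choose ℚ (by omega : 3 * k ≤ 6 * k),
      show 3 * k - k = 2 * k by omega, show 6 * k - 3 * k = 3 * k by omega]
    have := Nat.factorial_ne_zero (3 * k)
    field_simp
  induction k with
  | zero => simp
  | succ k ih =>
    rw [prod_range_succ, ← ih, hf, hf, show 6 * (k + 1) = 6 * k + 5 + 1 by ring,
      show 2 * (k + 1) = 2 * k + 1 + 1 by ring, show 3 * (k + 1) = 3 * k + 2 + 1 by ring]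
    simp only [Nat.factorial]
    have h1 := Nat.factorial_ne_zero (3 * k)
    have h2 := Nat.factorial_ne_zero (2 * k)
    have h3 := Nat.factorial_ne_zero k
    push_cast
    field_simp
    ring

/-- The coefficient of `X ^ k` in the shifted Legendre polynomial of degree `n`. -/
def legendreCoeff (n k : ℕ) : ℚ := (-1) ^ k * n.choose k * (n + k).choose n

lemma legendreCoeff_of_lt {n k : ℕ} (h : n < k) : legendreCoeff n k = 0 := by
  simp [legendreCoeff, Nat.choose_eq_zero_of_lt h]

lemma legendreCoeff_mem_pIntegers (p : ℕ) [Fact p.Prime] (n k : ℕ) :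
    legendreCoeff n k ∈ pIntegers p :=
  mul_mem (mul_mem (pow_mem (neg_mem (one_mem _)) _) (natCast_mem _ _)) (natCast_mem _ _)

lemma cast_choose_succ_right (n k : ℕ) :
    (n.choose (k + 1) : ℚ) * (k + 1) = n.choose k * (n - k) := by
  rcases le_or_gt k n with h | h
  · have := Nat.choose_succ_right_eq n k
    rw [← Nat.cast_sub h]
    exact_mod_cast this
  · simp [Nat.choose_eq_zero_of_lt h, Nat.choose_eq_zero_of_lt (h.trans k.lt_succ_self)]

lemma cast_choose_succ_left (n k : ℕ) :
    ((n + k + 1).choose n : ℚ) * (k + 1) = (n + k).choose n * (n + k + 1) := by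
  have := Nat.choose_mul_succ_eq (n + k) n
  rw [show n + k + 1 - n = k + 1 by omega] at this
  exact_mod_cast this.symm

lemma legendreCoeff_eq_prod (n k : ℕ) :
    legendreCoeff n k = ∏ j ∈ range k, ((j : ℚ) - n) * (n + 1 + j) / ((j : ℚ) + 1) ^ 2 := by
  induction k with
  | zero => simp [legendreCoeff]
  | succ k ih =>
    rw [prod_range_succ, ← ih]
    have h1 := cast_choose_succ_right n k
    have h2 := cast_choose_succ_left n k
    have h3 : ((k : ℚ) + 1) ≠ 0 := by positivity
    rw [← eq_div_iff h3] at h1 h2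
    simp only [legendreCoeff, ← add_assoc]
    rw [h1, h2, pow_succ]
    field_simp
    ring

lemma sum_legendreCoeff (n : ℕ) : ∑ k ∈ range (n + 1), legendreCoeff n k = (-1) ^ n := by
  have h := Polynomial.shiftedLegendre_eval_symm n (1 : ℚ)
  have h0 : (Polynomial.aeval (0 : ℚ)) (Polynomial.shiftedLegendre n) = 1 := by
    rw [Polynomial.aeval_def, Polynomial.eval₂_at_zero, Polynomial.coeff_shiftedLegendre]
    simp
  rw [sub_self, h0, mul_one, Polynomial.shiftedLegendre] at h
  simpa [legendreCoeff] using h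

lemma sub_mul_legendreCoeff_succ (n k : ℕ) :
    ((n : ℚ) + 1 - k) * legendreCoeff (n + 1) k = (n + 1 + k) * legendreCoeff n k := by
  have h1 : ((n + 1).choose k : ℚ) * (n + 1 - k) = n.choose k * (n + 1) := by
    rcases le_or_gt k (n + 1) with h | h
    · have := Nat.choose_mul_succ_eq n k
      have h' : ((n + 1 - k : ℕ) : ℚ) = n + 1 - k := by push_cast [Nat.cast_sub h]; ring
      rw [← h']
      exact_mod_cast this.symm
    · simp [Nat.choose_eq_zero_of_lt h, Nat.choose_eq_zero_of_lt (by omega : n < k)]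
  have h2 : ((n + 1 + k).choose (n + 1) : ℚ) * (n + 1) = (n + k).choose n * (n + 1 + k) := by
    have := Nat.add_one_mul_choose_eq (n + k) n
    rw [show n + 1 + k = n + k + 1 by ring]
    have h := congrArg (Nat.cast (R := ℚ)) this
    push_cast at h
    linarith
  have h3 : ((n : ℚ) + 1) ≠ 0 := by positivity
  simp only [legendreCoeff]
  apply mul_right_cancel₀ h3
  linear_combination (-1 : ℚ) ^ k * ((n + 1 + k).choose (n + 1) : ℚ) * (n + 1) * h1 +
    (-1 : ℚ) ^ k * (n.choose k : ℚ) * (n + 1) * h2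

/-- Partial fraction expansion of `∏ (j + 1 - x) / ∏ (j + x)`. -/
lemma sum_legendreCoeff_div (n : ℕ) {x : ℚ} (hx : 0 < x) :
    (n + x) * ∑ k ∈ range (n + 1), legendreCoeff n k / (k + x) =
      ∏ j ∈ range n, ((j : ℚ) + 1 - x) / (j + x) := by
  induction n with
  | zero => simp [legendreCoeff, hx.ne']
  | succ n ih =>
    have key : ((n : ℚ) + 1 + x) * ∑ k ∈ range (n + 2), legendreCoeff (n + 1) k / (k + x) =
        (n + 1 - x) * ∑ k ∈ range (n + 2), legendreCoeff n k / (k + x) := by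
      have hsum : ∑ k ∈ range (n + 2), (legendreCoeff (n + 1) k + legendreCoeff n k) = 0 := by
        rw [sum_add_distrib, sum_legendreCoeff, sum_range_succ _ (n + 1), sum_legendreCoeff,
          legendreCoeff_of_lt n.lt_succ_self]
        ring
      rw [← sub_eq_zero, mul_sum, mul_sum, ← sum_sub_distrib, ← hsum]
      refine sum_congr rfl fun k _ => ?_
      have := sub_mul_legendreCoeff_succ n k
      have hk : (k : ℚ) + x ≠ 0 := by positivity
      field_simp
      linear_combination this
    have hn : (n : ℚ) + x ≠ 0 := by positivity
    rw [prod_range_succ, ← ih]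
    push_cast
    rw [key, sum_range_succ _ (n + 1), legendreCoeff_of_lt n.lt_succ_self]
    field_simp
    ring

end HypergeometricTerm

section Harmonic

lemma sum_range_inv_add (m k : ℕ) :
    ∑ j ∈ range k, ((m : ℚ) + 1 + j)⁻¹ = harmonic (m + k) - harmonic m := by
  rw [harmonic, harmonic, sum_range_add, add_sub_cancel_left]
  refine sum_congr rfl fun j _ => ?_
  push_cast
  ring

lemma sum_alternating_inv (m : ℕ) :
    ∑ i ∈ range (2 * m), (-1 : ℚ) ^ i * ((i : ℚ) + 1)⁻¹ = harmonic (2 * m) - harmonic m := by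
  induction m with
  | zero => simp
  | succ m ih =>
    rw [show 2 * (m + 1) = 2 * m + 1 + 1 by ring, sum_range_succ, sum_range_succ, ih,
      harmonic_succ, harmonic_succ, harmonic_succ, pow_succ, pow_mul]
    push_cast
    norm_num
    field_simp
    ring

lemma harmonic_two_mul (m : ℕ) :
    harmonic (2 * m) = harmonic m / 2 + ∑ i ∈ range m, (2 * (i : ℚ) + 1)⁻¹ := by
  induction m with
  | zero => simp
  | succ m ih =>
    rw [show 2 * (m + 1) = 2 * m + 1 + 1 by ring, sum_range_succ, harmonic_succ, harmonic_succ,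
      harmonic_succ, ih]
    push_cast
    field_simp
    ring

variable {p : ℕ} [hp : Fact p.Prime]

lemma pCong_choose_prime_sub_one {i : ℕ} (hi : i < p) :
    pCong p 1 ((p - 1).choose i : ℚ) ((-1) ^ i) := by
  induction i with
  | zero => simpa using pCong_refl (p := p) 1 1
  | succ i ih =>
    obtain ⟨c, hc⟩ := hp.out.dvd_choose_self i.succ_ne_zero hi
    have h : (p - 1).choose i + (p - 1).choose (i + 1) = p * c := by
      rw [← hc, ← Nat.choose_succ_succ, Nat.succ_eq_add_one, Nat.sub_add_cancel hp.out.one_le]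
    obtain ⟨r, hr, h'⟩ := pCong_iff.1 (ih (by omega))
    have h2 : ((p - 1).choose i : ℚ) + (p - 1).choose (i + 1) = p * c := by exact_mod_cast h
    exact pCong_of_eq_add (sub_mem (natCast_mem _ c) hr) (by linear_combination h2 - h')

lemma two_pow_prime_sub_two :
    (2 : ℚ) ^ p - 2 = p * ∑ i ∈ range (p - 1), ((p - 1).choose i : ℚ) * ((i : ℚ) + 1)⁻¹ := by
  obtain ⟨m, rfl⟩ : ∃ m, p = m + 1 := ⟨p - 1, (Nat.sub_add_cancel hp.out.one_le).symm⟩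
  have h := Nat.sum_range_choose (m + 1)
  rw [sum_range_succ, sum_range_succ'] at h
  have h' := congrArg (Nat.cast (R := ℚ)) h
  push_cast at h'
  simp only [Nat.choose_zero_right, Nat.choose_self, Nat.add_sub_cancel] at h' ⊢
  rw [← h', mul_sum]
  have : ∀ i ∈ range m, ((m + 1 : ℕ) : ℚ) * ((m.choose i : ℚ) * ((i : ℚ) + 1)⁻¹) =
      (m + 1).choose (i + 1) := by
    intro i _
    have := congrArg (Nat.cast (R := ℚ)) (Nat.add_one_mul_choose_eq m i)
    push_cast at this ⊢
    field_simp
    linear_combination this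
  rw [sum_congr rfl this]
  push_cast
  ring

lemma pCong_harmonic_prime_sub_one (h2 : p ≠ 2) : pCong p 1 (harmonic (p - 1)) 0 := by
  have hinv : (2 : ℚ)⁻¹ ∈ pIntegers p := by
    have := hp.out.two_le
    simpa using inv_natCast_mem_pIntegers (p := p)
      (Nat.not_dvd_of_pos_of_lt two_pos (by omega))
  have hmem : ∀ i ∈ range (p - 1), ((i : ℚ) + 1)⁻¹ * (((p - 1 - 1 - i : ℕ) : ℚ) + 1)⁻¹ ∈
      pIntegers p := by
    intro i hi
    rw [mem_range] at hi
    exact mul_mem (inv_succ_mem_pIntegers (by omega)) (inv_succ_mem_pIntegers (by omega))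
  refine pCong_of_eq_add (mul_mem hinv (sum_mem hmem)) ?_
  have hH : harmonic (p - 1) = ∑ i ∈ range (p - 1), ((i : ℚ) + 1)⁻¹ := by
    simp [harmonic]
  have h : harmonic (p - 1) + harmonic (p - 1) =
      p * ∑ i ∈ range (p - 1), ((i : ℚ) + 1)⁻¹ * (((p - 1 - 1 - i : ℕ) : ℚ) + 1)⁻¹ := by
    have hR := sum_range_reflect (fun i : ℕ => ((i : ℚ) + 1)⁻¹) (p - 1)
    rw [← hH] at hR
    nth_rw 1 [← hR]
    rw [hH, ← sum_add_distrib, mul_sum]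
    refine sum_congr rfl fun i hi => ?_
    rw [mem_range] at hi
    have : (p : ℚ) = i + 1 + (((p - 1 - 1 - i : ℕ) : ℚ) + 1) := by
      exact_mod_cast (by omega : p = i + 1 + (p - 1 - 1 - i + 1))
    rw [this]
    field_simp
  linear_combination h / 2

lemma pCong_two_pow_prime_sub_two {n : ℕ} (hn : p = 6 * n + 1) (hn0 : n ≠ 0) :
    pCong p 2 ((2 : ℚ) ^ p - 2) (p * (harmonic (2 * n) - harmonic n)) := by
  have h1 : pCong p 1 (∑ i ∈ range (p - 1), ((p - 1).choose i : ℚ) * ((i : ℚ) + 1)⁻¹)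
      (harmonic (2 * (3 * n)) - harmonic (3 * n)) := by
    rw [← sum_alternating_inv, show 2 * (3 * n) = p - 1 by omega]
    refine pCong_sum fun i hi => ?_
    rw [mem_range] at hi
    rw [mul_comm, mul_comm ((-1 : ℚ) ^ i)]
    exact (pCong_choose_prime_sub_one (by omega)).mul_left (inv_succ_mem_pIntegers (by omega))
  have h2 : pCong p 1 (harmonic (2 * (3 * n)) - harmonic (3 * n)) (0 - harmonic (3 * n)) := by
    have := pCong_harmonic_prime_sub_one (p := p) (by omega)
    rw [show p - 1 = 2 * (3 * n) by omega] at this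
    exact this.sub (pCong_refl _ _)
  have h3 : pCong p 1 (∑ i ∈ range n, (2 * (i : ℚ) + 1)⁻¹)
      (-(1 / 2) * ∑ i ∈ range n, (((2 * n : ℕ) : ℚ) + 1 + i)⁻¹) := by
    rw [← sum_range_reflect (fun i : ℕ => (((2 * n : ℕ) : ℚ) + 1 + i)⁻¹), mul_sum]
    refine pCong_sum fun i hi => ?_
    rw [mem_range] at hi
    have ha : ((2 * i + 1 : ℕ) : ℚ)⁻¹ ∈ pIntegers p :=
      inv_natCast_mem_pIntegers (Nat.not_dvd_of_pos_of_lt (by omega) (by omega))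
    have hb : ((2 * (3 * n - i) : ℕ) : ℚ)⁻¹ ∈ pIntegers p :=
      inv_natCast_mem_pIntegers (Nat.not_dvd_of_pos_of_lt (by omega) (by omega))
    refine pCong_of_eq_add (mul_mem ha hb) ?_
    obtain ⟨m, rfl⟩ : ∃ m, n = i + 1 + m := ⟨n - (i + 1), by omega⟩
    rw [show i + 1 + m - 1 - i = m by omega,
      show 3 * (i + 1 + m) - i = 2 * (i + 1 + m) + 1 + m by omega, hn]
    push_cast
    have e1 : 2 * (i : ℚ) + 1 ≠ 0 := by positivity
    have e2 : 2 * ((i : ℚ) + 1 + m) + 1 + m ≠ 0 := by positivity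
    field_simp
    ring
  rw [sum_range_inv_add, show 2 * n + n = 3 * n by ring] at h3
  rw [two_pow_prime_sub_two]
  refine ((h1.trans h2).trans (pCong.symm ?_)).prime_mul
  have h4 := harmonic_two_mul n
  have h5 := (h3.mul_left (natCast_mem _ 2)).sub (pCong_refl 1 (harmonic (2 * n)))
  convert h5 using 1 <;> push_cast <;> linarith

end Harmonic

section Supercongruence

lemma not_dvd_six_mul_add_one {p n k : ℕ} (hn : p = 6 * n + 1) (hk : k < p) (hkn : k ≠ n) :
    ¬ p ∣ 6 * k + 1 := by
  rintro ⟨m, hm⟩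
  have hm6 : m < 6 := by
    by_contra! h
    have := Nat.mul_le_mul_left p h
    omega
  interval_cases m <;> omega

variable {p : ℕ} [hp : Fact p.Prime]

lemma pCong_hypergeometric_legendreCoeff {n k : ℕ} (hn : p = 6 * n + 1) (hn0 : n ≠ 0)
    (hk : k < p) :
    pCong p 1 (((3 * k).choose k : ℚ) * ((6 * k).choose (3 * k) : ℚ) / 432 ^ k)
      (legendreCoeff n k) := by
  have h6 : (((6 : ℕ) : ℚ))⁻¹ ∈ pIntegers p :=
    inv_natCast_mem_pIntegers (Nat.not_dvd_of_pos_of_lt (by omega) (by omega))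
  rw [choose_mul_choose_div_eq_prod, legendreCoeff_eq_prod]
  have hint (z : ℤ) : (z : ℚ) ∈ pIntegers p := intCast_mem _ z
  refine pCong_prod (fun j hj => ?_) fun j hj => ?_ <;> rw [mem_range] at hj <;>
    have hj' := inv_succ_mem_pIntegers (p := p) (by omega : j + 1 < p)
  · refine pCong_of_eq_add
      (mul_mem (mul_mem (hint (6 * j + 5 - 6 * j + 6 * n)) (pow_mem h6 2)) (pow_mem hj' 2)) ?_
    rw [hn]
    push_cast
    have : (j : ℚ) + 1 ≠ 0 := by positivity
    field_simp
    ring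
  · rw [div_eq_mul_inv, ← inv_pow]
    exact mul_mem (mul_mem (by exact_mod_cast hint (j - n)) (by exact_mod_cast hint (n + 1 + j)))
      (pow_mem hj' 2)

lemma pCong_hypergeometric_sum {n : ℕ} (hn : p = 6 * n + 1) (hn0 : n ≠ 0) :
    pCong p 2
      (∑ k ∈ range p, ((3 * k).choose k : ℚ) * ((6 * k).choose (3 * k) : ℚ) / 432 ^ k *
        ((p : ℚ) / (6 * (k : ℚ) + 1)))
      (((3 * n).choose n : ℚ) * ((6 * n).choose (3 * n) : ℚ) / 432 ^ n - legendreCoeff n n +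
        ∏ j ∈ range n, (6 * (j : ℚ) + 5) / (6 * j + 1)) := by
  have hsum : ∏ j ∈ range n, (6 * (j : ℚ) + 5) / (6 * j + 1) =
      ∑ k ∈ range p, legendreCoeff n k * ((p : ℚ) / (6 * (k : ℚ) + 1)) := by
    rw [← sum_subset (range_subset_range.2 (by omega : n + 1 ≤ p)) fun k _ hk => by
      rw [legendreCoeff_of_lt (by simpa using hk), zero_mul]]
    have h := sum_legendreCoeff_div n (x := 1 / 6) (by norm_num)
    rw [mul_sum] at h
    refine Eq.trans ?_ (h.symm.trans ?_)
    · refine prod_congr rfl fun j _ => ?_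
      have : 6 * (j : ℚ) + 1 ≠ 0 := by positivity
      field_simp
      ring
    · refine sum_congr rfl fun k _ => ?_
      have : 6 * (k : ℚ) + 1 ≠ 0 := by positivity
      rw [hn]
      push_cast
      field_simp
  have hite := sum_ite_eq' (range p) n fun _ =>
    ((3 * n).choose n : ℚ) * ((6 * n).choose (3 * n) : ℚ) / 432 ^ n - legendreCoeff n n
  rw [if_pos (mem_range.2 (by omega))] at hite
  rw [hsum, ← hite, ← sum_add_distrib]
  refine pCong_sum fun k hk => ?_
  rw [mem_range] at hk
  split_ifs with hkn
  · subst hkn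
    have : (p : ℚ) / (6 * (k : ℚ) + 1) = 1 := by
      rw [hn]
      push_cast
      exact div_self (by positivity)
    rw [this, mul_one, mul_one, sub_add_cancel]
    exact pCong_refl _ _
  · have h1 := inv_natCast_mem_pIntegers (not_dvd_six_mul_add_one hn hk hkn)
    have h2 := ((pCong_hypergeometric_legendreCoeff hn hn0 hk).mul_left h1).prime_mul
    convert h2 using 1 <;> push_cast <;> ring

lemma pCong_hypergeometric_sum_prod {n : ℕ} (hn : p = 6 * n + 1) (hn0 : n ≠ 0) :
    pCong p 2
      (∑ k ∈ range p, ((3 * k).choose k : ℚ) * ((6 * k).choose (3 * k) : ℚ) / 432 ^ k *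
        ((p : ℚ) / (6 * (k : ℚ) + 1)))
      (legendreCoeff n n *
        (2 * (1 - p * (1 / 6 * (harmonic (2 * n) - harmonic n))) - 1)) := by
  have h6 : (6 : ℚ)⁻¹ ∈ pIntegers p := by
    simpa using inv_natCast_mem_pIntegers (p := p) (d := 6)
      (Nat.not_dvd_of_pos_of_lt (by omega) (by omega))
  have hneg (j : ℕ) (hj : j < n) : (j : ℚ) - n ≠ 0 := by
    rw [sub_ne_zero]
    exact_mod_cast hj.ne
  set A : ℚ := ∏ j ∈ range n, (6 * (j : ℚ) + 1) / (6 * (j - n)) with hA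
  set B : ℚ := ∏ j ∈ range n, (6 * (j : ℚ) + 5) / (6 * (n + 1 + j)) with hB
  have hA0 : A ≠ 0 := prod_ne_zero_iff.2 fun j hj =>
    div_ne_zero (by positivity) (mul_ne_zero (by norm_num) (hneg j (mem_range.1 hj)))
  have h1 : ((3 * n).choose n : ℚ) * ((6 * n).choose (3 * n) : ℚ) / 432 ^ n =
      legendreCoeff n n * (A * B) := by
    rw [choose_mul_choose_div_eq_prod, legendreCoeff_eq_prod, hA, hB, ← prod_mul_distrib,
      ← prod_mul_distrib]
    refine prod_congr rfl fun j hj => ?_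
    have := hneg j (mem_range.1 hj)
    field_simp
    ring
  have hsq : ∏ j ∈ range n, (((j : ℚ) - n) / (j + 1)) ^ 2 = 1 := by
    have : ∏ j ∈ range n, ((n : ℚ) - j) = ∏ j ∈ range n, ((j : ℚ) + 1) := by
      rw [← prod_range_reflect]
      refine prod_congr rfl fun j hj => ?_
      rw [mem_range] at hj
      have : (n : ℚ) = ((n - 1 - j : ℕ) : ℚ) + j + 1 := by
        exact_mod_cast (by omega : n = n - 1 - j + j + 1)
      linear_combination this
    have h0 : ∏ j ∈ range n, ((j : ℚ) + 1) ≠ 0 := prod_ne_zero_iff.2 fun j _ => by positivity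
    simp_rw [div_pow, sub_sq_comm _ (n : ℚ)]
    rw [prod_div_distrib, prod_pow, prod_pow, this, div_self (pow_ne_zero _ h0)]
  have h2 : ∏ j ∈ range n, (6 * (j : ℚ) + 5) / (6 * j + 1) = legendreCoeff n n * (B / A) := by
    refine (mul_one _).symm.trans ((congrArg _ hsq.symm).trans ?_)
    rw [legendreCoeff_eq_prod, hA, hB, ← prod_mul_distrib, ← prod_div_distrib,
      ← prod_mul_distrib]
    refine prod_congr rfl fun j hj => ?_
    have := hneg j (mem_range.1 hj)
    field_simp
  obtain ⟨a, ha, hAa⟩ : ∃ a ∈ pIntegers p, A⁻¹ = 1 + p * a := by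
    have hmem : ∀ j ∈ range n, -((6 * j + 1 : ℕ) : ℚ)⁻¹ ∈ pIntegers p := fun j hj => by
      rw [mem_range] at hj
      exact neg_mem (inv_natCast_mem_pIntegers
        (Nat.not_dvd_of_pos_of_lt (by omega) (by omega)))
    obtain ⟨r, hr, h⟩ := pCong_iff.1 (pCong_prod_one_add hmem)
    refine ⟨_, add_mem (sum_mem hmem) (mul_mem (natCast_mem _ p) hr), ?_⟩
    rw [mul_add, ← add_assoc, ← mul_assoc, ← pow_two, ← h, hA, ← prod_inv_distrib]
    refine prod_congr rfl fun j hj => ?_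
    rw [hn]
    push_cast
    field_simp
    ring
  have hHmem : 1 / 6 * (harmonic (2 * n) - harmonic n) ∈ pIntegers p := by
    rw [two_mul, ← sum_range_inv_add, one_div]
    refine mul_mem h6 (sum_mem fun j hj => ?_)
    rw [mem_range] at hj
    have := inv_succ_mem_pIntegers (p := p) (j := n + j) (by omega)
    push_cast at this
    rwa [add_right_comm] at this
  have hB' : pCong p 2 B (1 - p * (1 / 6 * (harmonic (2 * n) - harmonic n))) := by
    have hmem : ∀ j ∈ range n, -(1 / 6) * ((n : ℚ) + 1 + j)⁻¹ ∈ pIntegers p := fun j hj => by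
      rw [mem_range] at hj
      have h7 : ((n + 1 + j : ℕ) : ℚ)⁻¹ ∈ pIntegers p :=
        inv_natCast_mem_pIntegers (Nat.not_dvd_of_pos_of_lt (by omega) (by omega))
      push_cast at h7
      rw [one_div]
      exact mul_mem (neg_mem h6) h7
    convert pCong_prod_one_add hmem using 1
    · refine prod_congr rfl fun j _ => ?_
      have : (n : ℚ) + 1 + j ≠ 0 := by positivity
      rw [hn]
      push_cast
      field_simp
      ring
    · rw [← mul_sum, sum_range_inv_add, ← two_mul]
      ring
  have hAmem : A ∈ pIntegers p := prod_mem fun j hj => by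
    rw [mem_range] at hj
    have h7 : ((6 * (n - j) : ℕ) : ℚ)⁻¹ ∈ pIntegers p :=
      inv_natCast_mem_pIntegers (Nat.not_dvd_of_pos_of_lt (by omega) (by omega))
    convert mul_mem (neg_mem (natCast_mem (pIntegers p) (6 * j + 1))) h7 using 1
    have := hneg j hj
    have := sub_ne_zero.2 (sub_ne_zero.1 this).symm
    push_cast [Nat.cast_sub hj.le]
    field_simp
    ring
  have hBmem : B ∈ pIntegers p := hB'.mem <|
    sub_mem (one_mem _) (mul_mem (natCast_mem _ _) hHmem)
  have hsum : A * B + B * A⁻¹ - 1 = (2 * B - 1) + (p : ℚ) ^ 2 * (B * (A * a ^ 2)) := by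
    have : A + A⁻¹ - 2 = A * (A⁻¹ - 1) ^ 2 := by
      field_simp
      ring
    rw [hAa, add_sub_cancel_left] at this
    rw [hAa]
    linear_combination B * this
  refine (pCong_hypergeometric_sum hn hn0).trans ?_
  have hfac := pCong_of_eq_add (mul_mem hBmem (mul_mem hAmem (pow_mem ha 2))) hsum
  have h := hfac.trans ((hB'.mul_left (natCast_mem _ 2)).sub (pCong_refl 2 1))
  convert h.mul_left (legendreCoeff_mem_pIntegers p n n) using 1
  · rw [h1, h2]
    ring
  · push_cast
    rfl

end Supercongruence

theorem stmt11 (p : ℕ) (hp : p.Prime) (hp6 : p % 6 = 1) :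
    pCong p 2
      (∑ k ∈ Finset.range p,
        ((3 * k).choose k : ℚ) * ((6 * k).choose (3 * k) : ℚ) / 432 ^ k *
          ((p : ℚ) / (6 * (k : ℚ) + 1)))
      (((5 - (2 : ℚ) ^ p) / 3) * (-1 : ℚ) ^ ((p - 1) / 6) *
        (((p - 1) / 3).choose ((p - 1) / 6) : ℚ)) := by
  have : Fact p.Prime := ⟨hp⟩
  obtain ⟨n, hn⟩ : ∃ n, p = 6 * n + 1 := ⟨p / 6, by omega⟩
  have hn0 : n ≠ 0 := by
    have := hp.one_lt
    omega
  have h3 : ((3 : ℕ) : ℚ)⁻¹ ∈ pIntegers p :=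
    inv_natCast_mem_pIntegers (Nat.not_dvd_of_pos_of_lt (by omega) (by omega))
  refine (pCong_hypergeometric_sum_prod hn hn0).trans ?_
  have h := (pCong_refl 2 (1 : ℚ)).sub ((pCong_two_pow_prime_sub_two hn hn0).mul_left h3)
  convert (h.symm.mul_left (legendreCoeff_mem_pIntegers p n n)) using 1
  · push_cast
    ring
  · rw [show (p - 1) / 6 = n by omega, show (p - 1) / 3 = n + n by omega, legendreCoeff,
      Nat.choose_self]
    push_cast
    ring
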